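/- Let E₁ be a Banach space, 1 ≤ p < 2, X ∈ V^p([0,T],ℝ^n), f : E₁ → L(ℝ^n,E₁) γ-Hölder with 1 + γ > p, and set f_i(y) = f(y)(e_i) for the standard basis of ℝ^n; assume each f_i is continuously differentiable. Let g : E₁ → E₁ be a twice continuously differentiable vector field admitting a globally defined flow Φ : ℝ × E₁ → E₁ (so Φ_0 = id, ∂_t Φ_t(y) = g(Φ_t(y)) for all t, y, and each Φ_t is a twice continuously differentiable diffeomorphism), and suppose the Lie brackets vanish: [g, f_i](y) := Df_i(y)(g(y)) − Dg(y)(f_i(y)) = 0 for all y ∈ E₁ and i = 1,…,n. Then g is an infinitesimal symmetry of dY = Σ_i f_i(Y)dX^i: for every t ∈ ℝ, Φ_t is a symmetry, i.e. for every solution Y starting at y₀ the path Φ_t ∘ Y is a solution starting at Φ_t(y₀). -/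

import Mathlib

open Set Filter Topology

noncomputable section

/-- The `p`-variation of a path `X : ℝ → E` on the interval `[a,b]`,
`‖X‖_{p,[a,b]} = (sup_D Σ_i ‖X_{t_{i+1}} − X_{t_i}‖^p)^(1/p)`, the supremum being taken
over all finite partitions `a = t₀ ≤ t₁ ≤ … ≤ t_k = b`. -/
def pVar {E : Type*} [NormedAddCommGroup E] (p : ℝ) (X : ℝ → E) (a b : ℝ) : ENNReal :=
  ⨆ (k : ℕ) (t : Fin (k + 1) → ℝ)
    (_ : Monotone t ∧ t 0 = a ∧ t (Fin.last k) = b),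
    (∑ i : Fin k, (‖X (t i.succ) - X (t i.castSucc)‖₊ : ENNReal) ^ p) ^ (1 / p)

/-- `X ∈ V^p([a,b],E)`: `X` is continuous on `[a,b]` and has finite `p`-variation there. -/
def MemVp {E : Type*} [NormedAddCommGroup E] (p : ℝ) (X : ℝ → E) (a b : ℝ) : Prop :=
  ContinuousOn X (Set.Icc a b) ∧ pVar p X a b < ⊤

/-- A partition `a = t₀ ≤ t₁ ≤ … ≤ t_k = b` of `[a,b]`. -/
structure YoungPartition (a b : ℝ) where
  k : ℕ
  t : Fin (k + 1) → ℝ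
  mono : Monotone t
  first : t 0 = a
  last : t (Fin.last k) = b

/-- The mesh of a partition. -/
def YoungPartition.mesh {a b : ℝ} (D : YoungPartition a b) : ℝ :=
  ⨆ i : Fin D.k, (D.t i.succ - D.t i.castSucc)

/-- The Riemann sum `Σ_i Z_{t_i}(X_{t_{i+1}} − X_{t_i})` along a partition. -/
def riemannSum {E F : Type*} [NormedAddCommGroup E] [NormedSpace ℝ E]
    [NormedAddCommGroup F] [NormedSpace ℝ F]
    (Z : ℝ → E →L[ℝ] F) (X : ℝ → E) {a b : ℝ} (D : YoungPartition a b) : F :=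
  ∑ i : Fin D.k, Z (D.t i.castSucc) (X (D.t i.succ) - X (D.t i.castSucc))

/-- `IsYoungIntegral Z X a b I` : the Riemann sums of `Z` against `X` over partitions of `[a,b]`
converge to `I` as the mesh tends to `0`; i.e. the Young integral `∫_a^b Z dX` exists and
equals `I`. -/
def IsYoungIntegral {E F : Type*} [NormedAddCommGroup E] [NormedSpace ℝ E]
    [NormedAddCommGroup F] [NormedSpace ℝ F]
    (Z : ℝ → E →L[ℝ] F) (X : ℝ → E) (a b : ℝ) (I : F) : Prop :=
  Filter.Tendsto (fun D : YoungPartition a b => riemannSum Z X D)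
    (Filter.comap YoungPartition.mesh (nhds 0)) (nhds I)

/-- View a vector `v : E` as the continuous linear map `ℝ →L[ℝ] E`, `c ↦ c • v`; used to
integrate vector-valued integrands against scalar integrators. -/
def toCLM {E : Type*} [NormedAddCommGroup E] [NormedSpace ℝ E] (v : E) : ℝ →L[ℝ] E :=
  (1 : ℝ →L[ℝ] ℝ).smulRight v

/-- The `α`-Hölder seminorm `‖X‖_{α;H} = sup_{s ≠ t ∈ [a,b]} ‖X_t − X_s‖ / |t−s|^α` of a path. -/
def holderSemiPath {E : Type*} [NormedAddCommGroup E] (α : ℝ) (X : ℝ → E) (a b : ℝ) : ENNReal :=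
  ⨆ (s : Set.Icc a b) (t : Set.Icc a b) (_ : (s : ℝ) ≠ (t : ℝ)),
    (‖X (t : ℝ) - X (s : ℝ)‖₊ : ENNReal) / edist (s : ℝ) (t : ℝ) ^ α

/-- The `α`-Hölder norm (sup norm plus Hölder seminorm) of a path on `[a,b]`. -/
def holderNormPath {E : Type*} [NormedAddCommGroup E] (α : ℝ) (X : ℝ → E) (a b : ℝ) : ENNReal :=
  (⨆ t : Set.Icc a b, (‖X (t : ℝ)‖₊ : ENNReal)) + holderSemiPath α X a b

/-- The `γ`-Hölder constant `‖f‖_{γ,H} = sup_{x ≠ y} ‖f x − f y‖ / ‖x − y‖^γ` of a map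
between normed spaces. -/
def holderConst {E F : Type*} [NormedAddCommGroup E] [NormedAddCommGroup F]
    (γ : ℝ) (f : E → F) : ENNReal :=
  ⨆ (x : E) (y : E) (_ : x ≠ y), (‖f x - f y‖₊ : ENNReal) / (‖x - y‖₊ : ENNReal) ^ γ
/-- `Y` is a solution on `[0,T]` of the Young equation `dY = Σ_{i=1}^n f_i(Y) dX^i`
starting at `y₀`, where `f_i(y) = f(y)(e_i)` for the standard basis `e_i` of `ℝ^n` and
`X^i` are the coordinates of `X`: `Y ∈ V^p([0,T],E₁)` and
`Y_t = y₀ + Σ_i ∫_0^t f_i(Y_s) dX^i_s` (Young integrals). -/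
def IsYoungSolution {n : ℕ} {E₁ : Type*} [NormedAddCommGroup E₁] [NormedSpace ℝ E₁]
    (p T : ℝ) (X : ℝ → Fin n → ℝ) (f : E₁ → (Fin n → ℝ) →L[ℝ] E₁)
    (y₀ : E₁) (Y : ℝ → E₁) : Prop :=
  Y 0 = y₀ ∧ MemVp p Y 0 T ∧
  ∀ t ∈ Set.Icc (0 : ℝ) T, ∃ I : Fin n → E₁,
    (∀ i, IsYoungIntegral (fun s => toCLM (f (Y s) (Pi.single i 1)))
      (fun s => X s i) 0 t (I i)) ∧
    Y t = y₀ + ∑ i, I i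

section Flow

variable {E : Type*} [NormedAddCommGroup E] [NormedSpace ℝ E]

/-- A `C¹` map is strictly differentiable, uniformly along a compact set. -/
theorem ContDiff.exists_norm_sub_sub_fderiv_le_of_isCompact {g : E → E} (hg : ContDiff ℝ 1 g)
    {S : Set E} (hS : IsCompact S) {δ : ℝ} (hδ : 0 < δ) :
    ∃ r > 0, ∀ x ∈ S, ∀ a ∈ Metric.ball x r, ∀ b ∈ Metric.ball x r,
      ‖g a - g b - fderiv ℝ g x (a - b)‖ ≤ δ * ‖a - b‖ := by
  have hcont : Continuous (fderiv ℝ g) := hg.continuous_fderiv one_ne_zero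
  have h := hS.uniformContinuousAt_of_continuousAt (fderiv ℝ g)
    (fun _ _ => hcont.continuousAt) (Metric.dist_mem_uniformity hδ)
  obtain ⟨r, hr, hr'⟩ := Metric.mem_uniformity_dist.1 h
  refine ⟨r, hr, fun x hx a ha b hb => ?_⟩
  refine (convex_ball x r).norm_image_sub_le_of_norm_fderiv_le'
    (fun z _ => hg.differentiable one_ne_zero z) (fun z hz => ?_) hb ha
  have h2 := hr' (Metric.mem_ball'.1 hz) hx
  simp only [mem_ofPred_eq, dist_eq_norm] at h2
  rw [norm_sub_rev]
  exact h2.le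

variable {g w : E → E} {Φ : ℝ → E → E}

/-- First-order expansion of a flow in the direction of a commuting vector field. -/
theorem eventually_norm_flow_sub_le (hg : ContDiff ℝ 1 g) (hΦ0 : ∀ y, Φ 0 y = y)
    (hflow : ∀ (t : ℝ) (y : E), HasDerivAt (fun s => Φ s y) (g (Φ t y)) t)
    (hw : Differentiable ℝ w)
    (hbr : ∀ y, fderiv ℝ w y (g y) = fderiv ℝ g y (w y)) {t : ℝ} (ht : 0 ≤ t) (y : E) :
    ∃ C > 0, ∀ δ > 0, ∀ᶠ ε in 𝓝[>] (0 : ℝ),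
      ‖Φ t (y + ε • w y) - Φ t y - ε • w (Φ t y)‖ ≤ ε * (δ * C) := by
  have hΦc : ∀ z, Continuous fun s => Φ s z := fun z =>
    continuous_iff_continuousAt.2 fun s => (hflow s z).continuousAt
  have hv : ∀ s, HasDerivAt (fun s => w (Φ s y)) (fderiv ℝ g (Φ s y) (w (Φ s y))) s := fun s => by
    rw [← hbr]
    exact (hw _).hasFDerivAt.comp_hasDerivAt s (hflow s y)
  have hS : IsCompact ((fun s => Φ s y) '' Icc 0 t) := isCompact_Icc.image (hΦc y)
  obtain ⟨M, hM⟩ := hS.exists_bound_of_continuousOn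
    (hg.continuous_fderiv one_ne_zero).continuousOn
  obtain ⟨N, hN⟩ := hS.exists_bound_of_continuousOn hw.continuous.continuousOn
  have hN0 : 0 ≤ N := (norm_nonneg _).trans (hN _ (mem_image_of_mem _ ⟨le_rfl, ht⟩))
  obtain ⟨r, hr, hgr⟩ := hg.exists_norm_sub_sub_fderiv_le_of_isCompact hS one_pos
  set K := M + 1 with hK
  have hK0 : 0 ≤ K := by
    have := (norm_nonneg _).trans (hM _ (mem_image_of_mem _ ⟨le_rfl, ht⟩))
    positivity
  refine ⟨Real.exp ((K + 1) * t), Real.exp_pos _, fun δ hδ => ?_⟩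
  obtain ⟨ρ, hρ, hgρ⟩ := hg.exists_norm_sub_sub_fderiv_le_of_isCompact hS
    (show 0 < δ / (N + 1) by positivity)
  have hsmall : ∀ (A b : ℝ), 0 < b → ∀ᶠ ε in 𝓝[>] (0 : ℝ), ε * A < b := fun A b hb => by
    have : Tendsto (fun ε : ℝ => ε * A) (𝓝[>] 0) (𝓝 0) := by
      have : ContinuousAt (fun ε : ℝ => ε * A) 0 := by fun_prop
      simpa [ContinuousAt] using this.mono_left nhdsWithin_le_nhds
    exact this.eventually (gt_mem_nhds hb)
  filter_upwards [self_mem_nhdsWithin, hsmall N ρ hρ, hsmall N (r / 2) (by positivity),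
    hsmall (δ * Real.exp ((K + 1) * t)) (r / 2) (by positivity)] with ε hε h1 h2 h3
  have hε : 0 < ε := hε
  have hder : ∀ s, HasDerivAt
      (fun s => Φ s (y + ε • w y) - Φ s y - ε • w (Φ s y))
      (g (Φ s (y + ε • w y)) - g (Φ s y) - ε • fderiv ℝ g (Φ s y) (w (Φ s y))) s := fun s =>
    ((hflow s _).sub (hflow s y)).sub ((hv s).const_smul ε)
  have hB : ∀ s, HasDerivAt (fun s => ε * (δ * Real.exp ((K + 1) * s)))
      ((K + 1) * (ε * (δ * Real.exp ((K + 1) * s)))) s := fun s => by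
    have := ((((hasDerivAt_id s).const_mul (K + 1)).exp).const_mul δ).const_mul ε
    exact this.congr_deriv (by simp only [id]; ring)
  refine image_norm_le_of_norm_deriv_right_lt_deriv_boundary (a := 0) (b := t)
    (f := fun s => Φ s (y + ε • w y) - Φ s y - ε • w (Φ s y))
    (fun s _ => (hder s).continuousAt.continuousWithinAt)
    (fun s _ => (hder s).hasDerivWithinAt) ?_ hB ?_ ⟨ht, le_rfl⟩
  · simp only [hΦ0, add_sub_cancel_left, sub_self, norm_zero]
    positivity
  · intro s hs heq
    have hmem : Φ s y ∈ (fun s => Φ s y) '' Icc 0 t := mem_image_of_mem _ ⟨hs.1, hs.2.le⟩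
    set c := Φ s y
    set a := Φ s (y + ε • w y)
    set v := w c
    set B := ε * (δ * Real.exp ((K + 1) * s)) with hBdef
    have hBr : B < r / 2 := by
      refine lt_of_le_of_lt ?_ h3
      have := hs.2.le
      rw [hBdef]; gcongr
    have hεB : ε * δ ≤ B := by
      have : 1 ≤ Real.exp ((K + 1) * s) := Real.one_le_exp (by have := hs.1; positivity)
      rw [hBdef]
      have : ε * (δ * 1) ≤ ε * (δ * Real.exp ((K + 1) * s)) := by gcongr
      simpa using this
    have hvN : ‖v‖ ≤ N := hN _ hmem
    have hεv : ‖ε • v‖ ≤ ε * N := by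
      rw [norm_smul, Real.norm_of_nonneg hε.le]; gcongr
    have hb : ∀ R, ε * N < R → c + ε • v ∈ Metric.ball c R := fun R hR => by
      rw [Metric.mem_ball, dist_eq_norm, add_sub_cancel_left]; exact hεv.trans_lt hR
    have hab : ‖a - (c + ε • v)‖ = B := by rw [← heq]; congr 1; abel
    have ha : a ∈ Metric.ball c r := by
      rw [Metric.mem_ball]
      calc dist a c ≤ dist a (c + ε • v) + dist (c + ε • v) c := dist_triangle _ _ _
        _ < r / 2 + r / 2 := add_lt_add (by rwa [dist_eq_norm, hab]) (hb _ h2)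
        _ = r := by ring
    have e1 := hgr c hmem a ha _ (hb r (h2.trans (by linarith)))
    have e2 := hgρ c hmem _ (hb ρ h1) c (Metric.mem_ball_self hρ)
    rw [add_sub_cancel_left, map_smul] at e2
    rw [hab] at e1
    have e3 : ‖fderiv ℝ g c (a - (c + ε • v))‖ ≤ M * B := by
      rw [← hab]
      exact (fderiv ℝ g c).le_of_opNorm_le (hM _ hmem) _
    have e4 : δ / (N + 1) * ‖ε • v‖ < ε * δ := by
      calc δ / (N + 1) * ‖ε • v‖ ≤ δ / (N + 1) * (ε * N) := by gcongr
        _ = ε * δ * (N / (N + 1)) := by ring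
        _ < ε * δ * 1 := by
            gcongr
            rw [div_lt_one (by positivity)]; linarith
        _ = ε * δ := mul_one _
    calc ‖g a - g c - ε • fderiv ℝ g c v‖
        = ‖(g a - g (c + ε • v) - fderiv ℝ g c (a - (c + ε • v)))
            + fderiv ℝ g c (a - (c + ε • v))
            + (g (c + ε • v) - g c - ε • fderiv ℝ g c v)‖ := by congr 1; abel
      _ ≤ 1 * B + M * B + δ / (N + 1) * ‖ε • v‖ :=
          (norm_add₃_le).trans (add_le_add (add_le_add e1 e3) e2)
      _ < (K + 1) * B := by rw [hK]; linarith

/-- The forward flow of `g` carries a vector field commuting with `g` to itself. -/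
theorem fderiv_flow_apply_of_nonneg (hg : ContDiff ℝ 1 g) (hΦ0 : ∀ y, Φ 0 y = y)
    (hflow : ∀ (t : ℝ) (y : E), HasDerivAt (fun s => Φ s y) (g (Φ t y)) t)
    (hw : Differentiable ℝ w)
    (hbr : ∀ y, fderiv ℝ w y (g y) = fderiv ℝ g y (w y)) {t : ℝ} (ht : 0 ≤ t) {y : E}
    (hd : DifferentiableAt ℝ (Φ t) y) :
    fderiv ℝ (Φ t) y (w y) = w (Φ t y) := by
  obtain ⟨C, hC, hCδ⟩ := eventually_norm_flow_sub_le hg hΦ0 hflow hw hbr ht y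
  have hline : HasDerivAt (fun ε : ℝ => Φ t (y + ε • w y)) (fderiv ℝ (Φ t) y (w y)) 0 :=
    hd.hasFDerivAt.hasLineDerivAt (w y)
  have hslope : Tendsto (slope (fun ε : ℝ => Φ t (y + ε • w y)) 0) (𝓝[>] 0)
      (𝓝 (fderiv ℝ (Φ t) y (w y))) :=
    (hasDerivAt_iff_tendsto_slope.1 hline).mono_left
      (nhdsWithin_mono (0 : ℝ) (fun ε (hε : 0 < ε) => hε.ne'))
  rw [← sub_eq_zero, ← norm_le_zero_iff]
  refine le_of_forall_pos_le_add fun η hη => ?_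
  refine le_of_tendsto (hslope.sub_const (w (Φ t y))).norm ?_
  filter_upwards [self_mem_nhdsWithin, hCδ (η / C) (by positivity)] with ε hε h
  have hε : 0 < ε := hε
  rw [div_mul_cancel₀ _ hC.ne'] at h
  have : slope (fun ε : ℝ => Φ t (y + ε • w y)) 0 ε - w (Φ t y)
      = ε⁻¹ • (Φ t (y + ε • w y) - Φ t y - ε • w (Φ t y)) := by
    rw [slope_def_module, smul_sub _ _ (ε • w (Φ t y)), inv_smul_smul₀ hε.ne']
    simp
  rw [this, norm_smul, Real.norm_of_nonneg (inv_nonneg.2 hε.le), zero_add]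
  rwa [inv_mul_le_iff₀ hε]

/-- The flow of `g` carries a vector field commuting with `g` to itself. -/
theorem fderiv_flow_apply (hg : ContDiff ℝ 1 g) (hΦ0 : ∀ y, Φ 0 y = y)
    (hflow : ∀ (t : ℝ) (y : E), HasDerivAt (fun s => Φ s y) (g (Φ t y)) t)
    (hw : Differentiable ℝ w)
    (hbr : ∀ y, fderiv ℝ w y (g y) = fderiv ℝ g y (w y)) {t : ℝ} {y : E}
    (hd : DifferentiableAt ℝ (Φ t) y) :
    fderiv ℝ (Φ t) y (w y) = w (Φ t y) := by
  rcases le_total 0 t with ht | ht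
  · exact fderiv_flow_apply_of_nonneg hg hΦ0 hflow hw hbr ht hd
  · have := fderiv_flow_apply_of_nonneg (g := -g) (Φ := fun s => Φ (-s)) (t := -t) (y := y) hg.neg
      (by simpa using hΦ0) (fun s z => by
        simpa [Function.comp_def] using (hflow (-s) z).scomp s (hasDerivAt_neg s)) hw
      (fun z => by simp [hbr z, fderiv_neg]) (by linarith) (by simpa using hd)
    simpa using this

end Flow

section Sewing

variable {F : Type*} [NormedAddCommGroup F]

theorem sum_range_sub_rpow_le {w : ℕ → ℝ} {θ : ℝ} (hθ : 1 ≤ θ) {N : ℕ}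
    (hw : ∀ i < N, w i ≤ w (i + 1)) :
    ∑ i ∈ Finset.range N, (w (i + 1) - w i) ^ θ ≤ (w N - w 0) ^ θ := by
  suffices h : w 0 ≤ w N ∧ ∑ i ∈ Finset.range N, (w (i + 1) - w i) ^ θ ≤ (w N - w 0) ^ θ from h.2
  induction N with
  | zero => simp [Real.zero_rpow (by linarith : θ ≠ 0)]
  | succ N ih =>
    obtain ⟨h0, h⟩ := ih fun i hi => hw i (hi.trans N.lt_succ_self)
    have h1 := hw N N.lt_succ_self
    refine ⟨h0.trans h1, ?_⟩
    rw [Finset.sum_range_succ]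
    have h2 := Real.add_rpow_le_rpow_add (sub_nonneg.2 h0) (sub_nonneg.2 h1) hθ
    calc _ ≤ (w N - w 0) ^ θ + (w (N + 1) - w N) ^ θ := by gcongr
      _ ≤ _ := h2
      _ = _ := by congr 1; ring

theorem exists_index_bisecting {w : ℕ → ℝ} {m n : ℕ} (hmn : m < n) (hw : w m ≤ w n) :
    ∃ j, m ≤ j ∧ j < n ∧ w j - w m ≤ (w n - w m) / 2 ∧ w n - w (j + 1) ≤ (w n - w m) / 2 := by
  by_contra! h
  have key : ∀ j, m ≤ j → j ≤ n → w j - w m ≤ (w n - w m) / 2 := by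
    intro j hj
    induction j, hj using Nat.le_induction with
    | base => intro _; linarith
    | succ j hj ih =>
      intro hjn
      have := h j hj hjn (ih (by omega))
      linarith
  have := h (n - 1) (by omega) (by omega) (key _ (by omega) (by omega))
  rw [Nat.sub_add_cancel (by omega)] at this
  linarith

/-- Discrete sewing lemma. -/
theorem norm_sum_Ico_sub_le {Ξ : ℕ → ℕ → F} {w : ℕ → ℝ} {θ A : ℝ} (hθ : 1 < θ) (hA : 0 ≤ A) {M N : ℕ}
    (hw : ∀ i j, M ≤ i → i ≤ j → j ≤ N → w i ≤ w j)
    (hΞ : ∀ i j k, M ≤ i → i ≤ j → j ≤ k → k ≤ N →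
      ‖Ξ i k - Ξ i j - Ξ j k‖ ≤ A * (w k - w i) ^ θ) (hMN : M ≤ N) :
    ‖∑ i ∈ Finset.Ico M N, Ξ i (i + 1) - Ξ M N‖
      ≤ 2 / (1 - 2 ^ (1 - θ)) * A * (w N - w M) ^ θ := by
  have hθ0 : θ ≠ 0 := by linarith
  have h2 : (2 : ℝ) ^ (1 - θ) < 1 := Real.rpow_lt_one_of_one_lt_of_neg one_lt_two (by linarith)
  set c := 2 / (1 - (2 : ℝ) ^ (1 - θ)) with hc
  have hc1 : c = 2 + c * 2 ^ (1 - θ) := by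
    have : c * (1 - (2 : ℝ) ^ (1 - θ)) = 2 := div_mul_cancel₀ _ (by linarith)
    linarith
  suffices key : ∀ d m n, M ≤ m → n = m + d → n ≤ N →
      ‖∑ i ∈ Finset.Ico m n, Ξ i (i + 1) - Ξ m n‖ ≤ c * A * (w n - w m) ^ θ from
    key (N - M) M N le_rfl (by omega) le_rfl
  intro d
  induction d using Nat.strong_induction_on with
  | _ d ih =>
  intro m n hm hn hnN
  rcases Nat.eq_zero_or_pos d with hd | hd
  · have hnm : n = m := by omega
    have := hΞ m m m hm le_rfl le_rfl (by omega)
    simp only [sub_self, zero_sub, norm_neg, Real.zero_rpow hθ0, mul_zero] at this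
    rw [hnm]
    simpa [Real.zero_rpow hθ0] using this
  · have hωn := hw m n hm (by omega) hnN
    obtain ⟨j, hj1, hj2, hj3, hj4⟩ := exists_index_bisecting (w := w) (by omega : m < n) hωn
    set ω := w n - w m with hω
    have hω0 : 0 ≤ ω := sub_nonneg.2 hωn
    have d1 := hΞ m j n hm hj1 hj2.le hnN
    have d2 := hΞ j (j + 1) n (hm.trans hj1) j.le_succ hj2 hnN
    have hjm := hw m j hm hj1 (by omega)
    have hjn := hw j n (by omega) (by omega) hnN
    have hjn' := hw (j + 1) n (by omega) (by omega) hnN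
    have i1 := ih (j - m) (by omega) m j hm (by omega) (by omega)
    have i2 := ih (n - (j + 1)) (by omega) (j + 1) n (by omega) (by omega) hnN
    have hsum : ∑ i ∈ Finset.Ico m n, Ξ i (i + 1) = ∑ i ∈ Finset.Ico m j, Ξ i (i + 1)
        + Ξ j (j + 1) + ∑ i ∈ Finset.Ico (j + 1) n, Ξ i (i + 1) := by
      rw [← Finset.sum_Ico_consecutive _ hj1 hj2.le, Finset.sum_eq_sum_Ico_succ_bot hj2, add_assoc]
    have hc0 : 0 ≤ c := by rw [hc]; apply div_nonneg <;> linarith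
    have hhalf : (ω / 2) ^ θ = 2 ^ (1 - θ) * ω ^ θ / 2 := by
      rw [Real.div_rpow hω0 two_pos.le, Real.rpow_sub two_pos, Real.rpow_one]
      ring
    have d2' : ‖Ξ j n - Ξ j (j + 1) - Ξ (j + 1) n‖ ≤ A * ω ^ θ := by
      refine d2.trans ?_
      gcongr
      linarith
    have i1' : ‖∑ i ∈ Finset.Ico m j, Ξ i (i + 1) - Ξ m j‖ ≤ c * A * (ω / 2) ^ θ := by
      refine i1.trans ?_
      gcongr
    have i2' : ‖∑ i ∈ Finset.Ico (j + 1) n, Ξ i (i + 1) - Ξ (j + 1) n‖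
        ≤ c * A * (ω / 2) ^ θ := by
      refine i2.trans ?_
      gcongr
    calc ‖∑ i ∈ Finset.Ico m n, Ξ i (i + 1) - Ξ m n‖
        = ‖(∑ i ∈ Finset.Ico m j, Ξ i (i + 1) - Ξ m j)
            + (∑ i ∈ Finset.Ico (j + 1) n, Ξ i (i + 1) - Ξ (j + 1) n)
            - ((Ξ m n - Ξ m j - Ξ j n) + (Ξ j n - Ξ j (j + 1) - Ξ (j + 1) n))‖ := by
          rw [hsum]; congr 1; abel
      _ ≤ (c * A * (ω / 2) ^ θ + c * A * (ω / 2) ^ θ) + (A * ω ^ θ + A * ω ^ θ) :=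
          (norm_sub_le _ _).trans (add_le_add ((norm_add_le _ _).trans (add_le_add i1' i2'))
            ((norm_add_le _ _).trans (add_le_add d1 d2')))
      _ = (2 + c * 2 ^ (1 - θ)) * (A * ω ^ θ) := by rw [hhalf]; ring
      _ = c * A * ω ^ θ := by rw [← hc1]; ring

/-- `t 0 = a ≤ t 1 ≤ … ≤ t N = b` is a subdivision of `[a,b]` with steps at most `δ`. -/
structure IsSubdivision (a b δ : ℝ) (N : ℕ) (t : ℕ → ℝ) : Prop where
  mono : Monotone t
  first : t 0 = a
  last : t N = b
  step : ∀ i < N, t (i + 1) - t i ≤ δ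

theorem IsSubdivision.mono_right {a b δ δ' : ℝ} {N : ℕ} {t : ℕ → ℝ} (h : IsSubdivision a b δ N t)
    (hδ : δ ≤ δ') : IsSubdivision a b δ' N t :=
  ⟨h.mono, h.first, h.last, fun i hi => (h.step i hi).trans hδ⟩

theorem exists_isSubdivision {a b δ : ℝ} (hab : a ≤ b) (hδ : 0 < δ) :
    ∃ N t, IsSubdivision a b δ N t := by
  obtain ⟨N, hN⟩ := exists_nat_ge ((b - a) / δ)
  refine ⟨N, fun i => min (a + i * δ) b, ?_, by simpa, ?_, fun i _ => ?_⟩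
  · intro i j hij
    dsimp only
    gcongr
  · rw [div_le_iff₀ hδ] at hN
    exact min_eq_right (by linarith)
  · push_cast
    rcases le_total (a + i * δ) b with h | h
    · rw [min_eq_left h]
      linarith [min_le_left (a + (i + 1) * δ) b]
    · rw [min_eq_right h]
      linarith [min_le_right (a + (i + 1) * δ) b]

theorem IsSubdivision.exists_append {a b c δ : ℝ} {N M : ℕ} {t t' : ℕ → ℝ}
    (h : IsSubdivision a b δ N t) (h' : IsSubdivision b c δ M t') :
    ∃ u, IsSubdivision a b δ N u ∧ IsSubdivision a c δ (N + M) u := by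
  set u : ℕ → ℝ := fun i => if i ≤ N then t i else t' (i - N) with hu
  have h1 : ∀ i ≤ N, u i = t i := fun i hi => if_pos hi
  have h2 : ∀ i, N ≤ i → u i = t' (i - N) := fun i hi => by
    rcases hi.eq_or_lt with rfl | hi
    · rw [h1 _ le_rfl, h.last, Nat.sub_self, h'.first]
    · exact if_neg (by omega)
  have hmono : Monotone u := monotone_nat_of_le_succ fun i => by
    rcases Nat.lt_or_ge i N with hi | hi
    · rw [h1 i hi.le, h1 (i + 1) hi]; exact h.mono i.le_succ
    · rw [h2 i hi, h2 (i + 1) (by omega)]; exact h'.mono (by omega)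
  have h0 : u 0 = a := (h1 0 N.zero_le).trans h.first
  have hstep : ∀ i < N, u (i + 1) - u i ≤ δ := fun i hi => by
    rw [h1 i hi.le, h1 (i + 1) hi]; exact h.step i hi
  refine ⟨u, ⟨hmono, h0, (h1 N le_rfl).trans h.last, hstep⟩, hmono, h0, ?_, fun i hi => ?_⟩
  · rw [h2 _ (by omega), Nat.add_sub_cancel_left, h'.last]
  · rcases Nat.lt_or_ge i N with hi' | hi'
    · exact hstep i hi'
    · rw [h2 i hi', h2 (i + 1) (by omega), Nat.sub_add_comm hi']
      exact h'.step _ (by omega)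

theorem exists_strictMonoOn_enumeration {R : Finset ℝ} (hR : R.Nonempty) :
    ∃ (M : ℕ) (r : ℕ → ℝ), Monotone r ∧ StrictMonoOn r (Iic M) ∧
      (∀ i, r i ∈ R) ∧ ∀ x ∈ R, ∃ i ≤ M, r i = x := by
  obtain ⟨M, hM⟩ : ∃ M, R.card = M + 1 := ⟨R.card - 1, by have := hR.card_pos; omega⟩
  have hlt : ∀ i, min i M < M + 1 := fun i => by omega
  refine ⟨M, fun i => R.orderEmbOfFin hM ⟨min i M, hlt i⟩, fun i j hij => ?_, fun i hi j hj hij => ?_,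
    fun i => R.orderEmbOfFin_mem hM _, fun x hx => ?_⟩
  · refine (R.orderEmbOfFin hM).monotone ?_
    rw [Fin.mk_le_mk]; omega
  · refine (R.orderEmbOfFin hM).strictMono ?_
    rw [Fin.mk_lt_mk]; simp only [mem_Iic] at hi hj; omega
  · obtain ⟨⟨i, hi⟩, rfl⟩ : x ∈ Set.range (R.orderEmbOfFin hM) := by
      rwa [R.range_orderEmbOfFin hM, Finset.mem_coe]
    exact ⟨i, by omega, congrArg _ (Fin.ext (Nat.min_eq_left (by omega)))⟩

/-- A subdivision whose points are among those of `r` is indexed monotonically in `r`. -/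
theorem IsSubdivision.exists_index {a b δ : ℝ} {N M : ℕ} {t r : ℕ → ℝ}
    (h : IsSubdivision a b δ N t) (hr : StrictMonoOn r (Iic M))
    (hrab : ∀ i, r i ∈ Icc a b) (htr : ∀ i ≤ N, ∃ j ≤ M, r j = t i) :
    ∃ φ : ℕ → ℕ, φ 0 = 0 ∧ φ N = M ∧ (∀ i < N, φ i ≤ φ (i + 1)) ∧ ∀ i ≤ N, r (φ i) = t i := by
  choose! φ hφM hφ using htr
  refine ⟨φ, ?_, ?_, fun i hi => ?_, hφ⟩
  · have := (hrab 0).1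
    rw [← h.first, ← hφ 0 N.zero_le, hr.le_iff_le (hφM 0 N.zero_le) M.zero_le] at this
    omega
  · have := (hrab M).2
    rw [← h.last, ← hφ N le_rfl, hr.le_iff_le (mem_Iic.2 le_rfl) (hφM N le_rfl)] at this
    have := hφM N le_rfl
    omega
  · have := h.mono i.le_succ
    rwa [← hφ i hi.le, ← hφ (i + 1) hi, hr.le_iff_le (hφM i hi.le) (hφM (i + 1) hi)] at this

theorem IsSubdivision.mem_Icc {a b δ : ℝ} {N : ℕ} {t : ℕ → ℝ} (h : IsSubdivision a b δ N t)
    {i : ℕ} (hi : i ≤ N) : t i ∈ Icc a b :=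
  ⟨h.first ▸ h.mono i.zero_le, h.last ▸ h.mono hi⟩

/-- Common refinement of two subdivisions. -/
theorem IsSubdivision.exists_common_refinement {a b δ δ' : ℝ} {N N' : ℕ} {t t' : ℕ → ℝ}
    (h : IsSubdivision a b δ N t) (h' : IsSubdivision a b δ' N' t') :
    ∃ (M : ℕ) (r : ℕ → ℝ), Monotone r ∧
      (∃ φ : ℕ → ℕ, φ 0 = 0 ∧ φ N = M ∧ (∀ i < N, φ i ≤ φ (i + 1)) ∧ ∀ i ≤ N, r (φ i) = t i) ∧
      ∃ φ : ℕ → ℕ, φ 0 = 0 ∧ φ N' = M ∧ (∀ i < N', φ i ≤ φ (i + 1)) ∧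
        ∀ i ≤ N', r (φ i) = t' i := by
  classical
  set R := (Finset.range (N + 1)).image t ∪ (Finset.range (N' + 1)).image t' with hR
  have ht : ∀ i ≤ N, t i ∈ R := fun i hi => Finset.mem_union_left _
    (Finset.mem_image_of_mem _ (Finset.mem_range.2 (by omega)))
  have ht' : ∀ i ≤ N', t' i ∈ R := fun i hi => Finset.mem_union_right _
    (Finset.mem_image_of_mem _ (Finset.mem_range.2 (by omega)))
  obtain ⟨M, r, hmono, hstrict, hrR, hsurj⟩ :=
    exists_strictMonoOn_enumeration ⟨_, ht 0 N.zero_le⟩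
  have hrab : ∀ i, r i ∈ Icc a b := fun i => by
    rcases Finset.mem_union.1 (hrR i) with hi | hi
    · obtain ⟨j, hj, hji⟩ := Finset.mem_image.1 hi
      exact hji ▸ h.mem_Icc (Nat.lt_succ_iff.1 (Finset.mem_range.1 hj))
    · obtain ⟨j, hj, hji⟩ := Finset.mem_image.1 hi
      exact hji ▸ h'.mem_Icc (Nat.lt_succ_iff.1 (Finset.mem_range.1 hj))
  exact ⟨M, r, hmono, h.exists_index hstrict hrab fun i hi => hsurj _ (ht i hi),
    h'.exists_index hstrict hrab fun i hi => hsurj _ (ht' i hi)⟩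

theorem sum_range_sum_Ico {f : ℕ → F} {φ : ℕ → ℕ} {N : ℕ} (hφ : ∀ i < N, φ i ≤ φ (i + 1)) :
    φ 0 ≤ φ N ∧ ∑ i ∈ Finset.range N, ∑ j ∈ Finset.Ico (φ i) (φ (i + 1)), f j
      = ∑ j ∈ Finset.Ico (φ 0) (φ N), f j := by
  induction N with
  | zero => simp
  | succ N ih =>
    obtain ⟨h1, h2⟩ := ih fun i hi => hφ i (hi.trans N.lt_succ_self)
    have h3 := hφ N N.lt_succ_self
    exact ⟨h1.trans h3, by rw [Finset.sum_range_succ, h2, Finset.sum_Ico_consecutive _ h1 h3]⟩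

/-- The sums of the germ `Ξ` along subdivisions of `[a,b]` converge to `I`. -/
def SumsTendsto (Ξ : ℝ → ℝ → F) (a b : ℝ) (I : F) : Prop :=
  ∀ ε > 0, ∃ δ > 0, ∀ N t, IsSubdivision a b δ N t →
    ‖∑ i ∈ Finset.range N, Ξ (t i) (t (i + 1)) - I‖ ≤ ε

/-- The germ `Ξ` is additive up to an error `o((V t - V s) ^ θ)`. -/
def AlmostAdditive (Ξ : ℝ → ℝ → F) (V : ℝ → ℝ) (θ T : ℝ) : Prop :=
  ∀ ε > 0, ∃ δ > 0, ∀ s u t, 0 ≤ s → s ≤ u → u ≤ t → t ≤ T → t - s ≤ δ →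
    ‖Ξ s t - Ξ s u - Ξ u t‖ ≤ ε * (V t - V s) ^ θ

/-- The germ `Ξ` approximates the increments of `H` up to an error `o((V t - V s) ^ θ)`. -/
def ApproxIncrements (Ξ : ℝ → ℝ → F) (H : ℝ → F) (V : ℝ → ℝ) (θ T : ℝ) : Prop :=
  ∀ ε > 0, ∃ δ > 0, ∀ s t, 0 ≤ s → s ≤ t → t ≤ T → t - s ≤ δ →
    ‖H t - H s - Ξ s t‖ ≤ ε * (V t - V s) ^ θ

theorem SumsTendsto.unique {Ξ : ℝ → ℝ → F} {a b : ℝ} {I J : F} (hab : a ≤ b)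
    (hI : SumsTendsto Ξ a b I) (hJ : SumsTendsto Ξ a b J) : I = J := by
  rw [← sub_eq_zero, ← norm_le_zero_iff]
  refine le_of_forall_pos_le_add fun ε hε => ?_
  obtain ⟨δ, hδ, h⟩ := hI (ε / 2) (half_pos hε)
  obtain ⟨δ', hδ', h'⟩ := hJ (ε / 2) (half_pos hε)
  obtain ⟨N, t, ht⟩ := exists_isSubdivision hab (lt_min hδ hδ')
  have e1 := h N t (ht.mono_right (min_le_left _ _))
  have e2 := h' N t (ht.mono_right (min_le_right _ _))
  rw [norm_sub_rev] at e1
  calc ‖I - J‖ ≤ _ := norm_sub_le_norm_sub_add_norm_sub _ _ _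
    _ ≤ ε / 2 + ε / 2 := add_le_add e1 e2
    _ = 0 + ε := by ring

theorem SumsTendsto.sum {ι : Type*} (S : Finset ι) {Ξ : ι → ℝ → ℝ → F} {a b : ℝ} {I : ι → F}
    (h : ∀ i ∈ S, SumsTendsto (Ξ i) a b (I i)) :
    SumsTendsto (fun s t => ∑ i ∈ S, Ξ i s t) a b (∑ i ∈ S, I i) := by
  classical
  induction S using Finset.induction_on with
  | empty => exact fun ε hε => ⟨1, one_pos, fun N t _ => by simpa using hε.le⟩
  | insert i S hi ih =>
    intro ε hε
    obtain ⟨δ, hδ, h1⟩ := h i (Finset.mem_insert_self i S) (ε / 2) (half_pos hε)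
    obtain ⟨δ', hδ', h2⟩ := ih (fun j hj => h j (Finset.mem_insert_of_mem hj)) (ε / 2) (half_pos hε)
    refine ⟨min δ δ', lt_min hδ hδ', fun N t ht => ?_⟩
    simp only [Finset.sum_insert hi, Finset.sum_add_distrib]
    rw [add_sub_add_comm]
    refine (norm_add_le _ _).trans ?_
    linarith [h1 N t (ht.mono_right (min_le_left _ _)), h2 N t (ht.mono_right (min_le_right _ _))]

variable {Ξ : ℝ → ℝ → F} {H : ℝ → F} {V : ℝ → ℝ} {θ T : ℝ}

theorem AlmostAdditive.norm_sum_Ico_sub_le (hΞ : AlmostAdditive Ξ V θ T)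
    (hV : MonotoneOn V (Icc 0 T)) (hθ : 1 < θ) {ε : ℝ} (hε : 0 < ε) :
    ∃ δ > 0, ∀ (r : ℕ → ℝ) (m n : ℕ), Monotone r → m ≤ n → 0 ≤ r m → r n ≤ T → r n - r m ≤ δ →
      ‖∑ i ∈ Finset.Ico m n, Ξ (r i) (r (i + 1)) - Ξ (r m) (r n)‖
        ≤ ε * (V (r n) - V (r m)) ^ θ := by
  have h2 : (2 : ℝ) ^ (1 - θ) < 1 := Real.rpow_lt_one_of_one_lt_of_neg one_lt_two (by linarith)
  have hc : 0 < 2 / (1 - (2 : ℝ) ^ (1 - θ)) := div_pos two_pos (by linarith)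
  obtain ⟨δ, hδ, h⟩ := hΞ (ε / (2 / (1 - (2 : ℝ) ^ (1 - θ)))) (by positivity)
  refine ⟨δ, hδ, fun r m n hr hmn h0 hT hmesh => ?_⟩
  have key := _root_.norm_sum_Ico_sub_le (Ξ := fun i j => Ξ (r i) (r j)) (w := fun i => V (r i)) hθ
    (show 0 ≤ ε / (2 / (1 - (2 : ℝ) ^ (1 - θ))) by positivity) (M := m) (N := n)
    (fun i j hi hij hj => hV ⟨h0.trans (hr hi), (hr (hij.trans hj)).trans hT⟩
      ⟨h0.trans (hr (hi.trans hij)), (hr hj).trans hT⟩ (hr hij))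
    (fun i j k hi hij hjk hk => h _ _ _ (h0.trans (hr hi)) (hr hij) (hr hjk) ((hr hk).trans hT)
      (by linarith [hr hi, hr hk])) hmn
  rwa [mul_div_cancel₀ _ hc.ne'] at key

theorem IsSubdivision.sum_sub_rpow_le {a b δ : ℝ} {N : ℕ} {t : ℕ → ℝ}
    (h : IsSubdivision a b δ N t) (hV : MonotoneOn V (Icc 0 T)) (hθ : 1 < θ) (ha : 0 ≤ a)
    (hb : b ≤ T) :
    ∑ i ∈ Finset.range N, (V (t (i + 1)) - V (t i)) ^ θ ≤ (V b - V a) ^ θ := by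
  have := sum_range_sub_rpow_le (w := fun i => V (t i)) hθ.le (N := N) fun i hi =>
    hV (Icc_subset_Icc ha hb (h.mem_Icc hi.le)) (Icc_subset_Icc ha hb (h.mem_Icc hi))
      (h.mono i.le_succ)
  rwa [h.first, h.last] at this

/-- A germ approximating the increments of `H` sums up to the increments of `H`. -/
theorem ApproxIncrements.sumsTendsto (hH : ApproxIncrements Ξ H V θ T)
    (hV : MonotoneOn V (Icc 0 T)) (hθ : 1 < θ) {a b : ℝ} (ha : 0 ≤ a) (hab : a ≤ b) (hb : b ≤ T) :
    SumsTendsto Ξ a b (H b - H a) := by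
  intro ε hε
  set W := (V b - V a) ^ θ
  have hW : 0 ≤ W := Real.rpow_nonneg
    (sub_nonneg.2 (hV ⟨ha, hab.trans hb⟩ ⟨ha.trans hab, hb⟩ hab)) _
  obtain ⟨δ, hδ, h⟩ := hH (ε / (W + 1)) (by positivity)
  refine ⟨δ, hδ, fun N t ht => ?_⟩
  have htel : H b - H a = ∑ i ∈ Finset.range N, (H (t (i + 1)) - H (t i)) := by
    rw [Finset.sum_range_sub (fun i => H (t i)), ht.first, ht.last]
  rw [norm_sub_rev, htel, ← Finset.sum_sub_distrib]
  calc _ ≤ ∑ i ∈ Finset.range N, ε / (W + 1) * (V (t (i + 1)) - V (t i)) ^ θ := by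
        refine (norm_sum_le _ _).trans (Finset.sum_le_sum fun i hi => ?_)
        have hi := Finset.mem_range.1 hi
        exact h _ _ (ha.trans (ht.mem_Icc hi.le).1) (ht.mono i.le_succ)
          ((ht.mem_Icc hi).2.trans hb) (ht.step i hi)
    _ ≤ ε / (W + 1) * W := by
        rw [← Finset.mul_sum]
        gcongr
        exact ht.sum_sub_rpow_le hV hθ ha hb
    _ ≤ ε := by
        rw [div_mul_eq_mul_div, div_le_iff₀ (by positivity)]
        nlinarith

/-- If the sums of an almost additive germ converge to the increments of `H`, the germ
approximates these increments. -/
theorem AlmostAdditive.approxIncrements (hΞ : AlmostAdditive Ξ V θ T)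
    (hV : MonotoneOn V (Icc 0 T)) (hθ : 1 < θ)
    (hH : ∀ t ∈ Icc 0 T, SumsTendsto Ξ 0 t (H t - H 0)) : ApproxIncrements Ξ H V θ T := by
  intro ε hε
  obtain ⟨δ, hδ, h⟩ := hΞ.norm_sum_Ico_sub_le hV hθ hε
  refine ⟨δ, hδ, fun s t hs hst ht hstδ => le_of_forall_pos_le_add fun η hη => ?_⟩
  obtain ⟨δ₁, hδ₁, h1⟩ := hH s ⟨hs, hst.trans ht⟩ (η / 2) (half_pos hη)
  obtain ⟨δ₂, hδ₂, h2⟩ := hH t ⟨hs.trans hst, ht⟩ (η / 2) (half_pos hη)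
  obtain ⟨N, t₁, ht₁⟩ := exists_isSubdivision hs (lt_min hδ₁ hδ₂)
  obtain ⟨M, t₂, ht₂⟩ := exists_isSubdivision hst (lt_min hδ₁ hδ₂)
  obtain ⟨u, hu, hu'⟩ := ht₁.exists_append ht₂
  have e1 := h1 N u (hu.mono_right (min_le_left _ _))
  have e2 := h2 _ u (hu'.mono_right (min_le_right _ _))
  have e3 := h u N (N + M) hu.mono (by omega) (hu.last ▸ hs) (hu'.last ▸ ht)
    (by rwa [hu.last, hu'.last])
  rw [hu.last, hu'.last] at e3
  rw [← Finset.sum_range_add_sum_Ico _ (Nat.le_add_right N M)] at e2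
  set A := ∑ i ∈ Finset.range N, Ξ (u i) (u (i + 1))
  set B := ∑ i ∈ Finset.Ico N (N + M), Ξ (u i) (u (i + 1))
  calc ‖H t - H s - Ξ s t‖
      = ‖(B - Ξ s t) + (A - (H s - H 0)) - (A + B - (H t - H 0))‖ := by congr 1; abel
    _ ≤ ε * (V t - V s) ^ θ + η / 2 + η / 2 :=
        (norm_sub_le _ _).trans (add_le_add ((norm_add_le _ _).trans (add_le_add e3 e1)) e2)
    _ = ε * (V t - V s) ^ θ + η := by ring

theorem AlmostAdditive.norm_sum_sub_sum_le (hΞ : AlmostAdditive Ξ V θ T)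
    (hV : MonotoneOn V (Icc 0 T)) (hθ : 1 < θ) {a b : ℝ} (ha : 0 ≤ a) (hab : a ≤ b) (hb : b ≤ T)
    {ε : ℝ} (hε : 0 < ε) :
    ∃ δ > 0, ∀ N t N' t', IsSubdivision a b δ N t → IsSubdivision a b δ N' t' →
      ‖∑ i ∈ Finset.range N, Ξ (t i) (t (i + 1))
        - ∑ i ∈ Finset.range N', Ξ (t' i) (t' (i + 1))‖ ≤ ε := by
  set W := (V b - V a) ^ θ
  have hW : 0 ≤ W := Real.rpow_nonneg
    (sub_nonneg.2 (hV ⟨ha, hab.trans hb⟩ ⟨ha.trans hab, hb⟩ hab)) _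
  obtain ⟨δ, hδ, h⟩ := hΞ.norm_sum_Ico_sub_le hV hθ
    (show 0 < ε / (2 * (W + 1)) by positivity)
  have key : ∀ N t M r, IsSubdivision a b δ N t → Monotone r →
      (∃ φ : ℕ → ℕ, φ 0 = 0 ∧ φ N = M ∧ (∀ i < N, φ i ≤ φ (i + 1)) ∧ ∀ i ≤ N, r (φ i) = t i) →
      ‖∑ i ∈ Finset.range M, Ξ (r i) (r (i + 1)) - ∑ i ∈ Finset.range N, Ξ (t i) (t (i + 1))‖
        ≤ ε / 2 := by
    rintro N t M r ht hr ⟨φ, hφ0, hφN, hφ, hφt⟩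
    have hs := (sum_range_sum_Ico (f := fun i => Ξ (r i) (r (i + 1))) hφ).2
    rw [hφ0, hφN, ← Finset.range_eq_Ico] at hs
    rw [← hs, ← Finset.sum_sub_distrib]
    calc _ ≤ ∑ i ∈ Finset.range N, ε / (2 * (W + 1)) * (V (t (i + 1)) - V (t i)) ^ θ := by
          refine (norm_sum_le _ _).trans (Finset.sum_le_sum fun i hi => ?_)
          have hi := Finset.mem_range.1 hi
          have e1 := hφt i hi.le
          have e2 := hφt (i + 1) hi
          have := h r _ _ hr (hφ i hi) (by rw [e1]; exact ha.trans (ht.mem_Icc hi.le).1)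
            (by rw [e2]; exact (ht.mem_Icc hi).2.trans hb) (by rw [e1, e2]; exact ht.step i hi)
          rwa [e1, e2] at this
      _ ≤ ε / (2 * (W + 1)) * W := by
          rw [← Finset.mul_sum]
          gcongr
          exact ht.sum_sub_rpow_le hV hθ ha hb
      _ ≤ ε / 2 := by
          rw [div_mul_eq_mul_div, div_le_div_iff₀ (by positivity) two_pos]
          nlinarith
  refine ⟨δ, hδ, fun N t N' t' ht ht' => ?_⟩
  obtain ⟨M, r, hr, h1, h2⟩ := ht.exists_common_refinement ht'
  have e1 := key N t M r ht hr h1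
  have e2 := key N' t' M r ht' hr h2
  rw [norm_sub_rev] at e1
  exact (norm_sub_le_norm_sub_add_norm_sub _ _ _).trans (by linarith)

/-- Sewing lemma: the sums of an almost additive germ converge. -/
theorem AlmostAdditive.exists_sumsTendsto [CompleteSpace F] (hΞ : AlmostAdditive Ξ V θ T)
    (hV : MonotoneOn V (Icc 0 T)) (hθ : 1 < θ) {a b : ℝ} (ha : 0 ≤ a) (hab : a ≤ b)
    (hb : b ≤ T) : ∃ I, SumsTendsto Ξ a b I := by
  choose N t ht using fun n : ℕ =>
    exists_isSubdivision hab (Nat.one_div_pos_of_nat (n := n) (α := ℝ))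
  set S : ℕ → F := fun n => ∑ i ∈ Finset.range (N n), Ξ (t n i) (t n (i + 1)) with hS
  have key : ∀ ε > 0, ∃ δ > 0, ∃ n₀ : ℕ, ∀ n ≥ n₀, ∀ M r, IsSubdivision a b δ M r →
      ‖∑ i ∈ Finset.range M, Ξ (r i) (r (i + 1)) - S n‖ ≤ ε ∧ ∀ m ≥ n₀, ‖S m - S n‖ ≤ ε := by
    intro ε hε
    obtain ⟨δ, hδ, h⟩ := hΞ.norm_sum_sub_sum_le hV hθ ha hab hb hε
    obtain ⟨n₀, hn₀⟩ := exists_nat_one_div_lt hδ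
    have hsub : ∀ n ≥ n₀, IsSubdivision a b δ (N n) (t n) := fun n hn =>
      (ht n).mono_right ((Nat.one_div_le_one_div hn).trans hn₀.le)
    exact ⟨δ, hδ, n₀, fun n hn M r hr =>
      ⟨h _ _ _ _ hr (hsub n hn), fun m hm => h _ _ _ _ (hsub m hm) (hsub n hn)⟩⟩
  have hC : CauchySeq S := Metric.cauchySeq_iff'.2 fun ε hε => by
    obtain ⟨δ, hδ, n₀, h⟩ := key (ε / 2) (half_pos hε)
    obtain ⟨M, r, hr⟩ := exists_isSubdivision hab hδ
    refine ⟨n₀, fun n hn => ?_⟩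
    rw [dist_eq_norm]
    exact ((h n₀ le_rfl M r hr).2 n hn).trans_lt (half_lt_self hε)
  obtain ⟨I, hI⟩ := cauchySeq_tendsto_of_complete hC
  refine ⟨I, fun ε hε => ?_⟩
  obtain ⟨δ, hδ, n₀, h⟩ := key ε hε
  refine ⟨δ, hδ, fun M r hr => le_of_tendsto (hI.const_sub _).norm ?_⟩
  filter_upwards [eventually_ge_atTop n₀] with n hn using (h n hn M r hr).1

end Sewing

section PVariation

variable {E F : Type*} [NormedAddCommGroup E] [NormedAddCommGroup F]

/-- The increments of `X` on `[0,T]` are controlled in `p`-variation by those of `V`. -/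
def IsPVarControl (p T : ℝ) (X : ℝ → E) (V : ℝ → ℝ) : Prop :=
  ∀ s t, 0 ≤ s → s ≤ t → t ≤ T → ‖X t - X s‖ ^ p ≤ V t - V s

theorem IsPVarControl.monotoneOn {p T : ℝ} {X : ℝ → E} {V : ℝ → ℝ} (h : IsPVarControl p T X V) :
    MonotoneOn V (Icc 0 T) := fun s hs t ht hst =>
  sub_nonneg.1 ((Real.rpow_nonneg (norm_nonneg _) p).trans (h s t hs.1 hst ht.2))

theorem IsPVarControl.add_right {p T : ℝ} {X : ℝ → E} {V W : ℝ → ℝ} (h : IsPVarControl p T X V)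
    (hW : MonotoneOn W (Icc 0 T)) : IsPVarControl p T X (V + W) := fun s t hs hst ht => by
  have h1 := h s t hs hst ht
  have h2 := hW ⟨hs, hst.trans ht⟩ ⟨hs.trans hst, ht⟩ hst
  simp only [Pi.add_apply]
  linarith

theorem IsPVarControl.of_norm_sub_le {p T L : ℝ} {X : ℝ → E} {Z : ℝ → F} {V : ℝ → ℝ}
    (h : IsPVarControl p T X V) (hp : 0 ≤ p) (hL : 0 ≤ L)
    (hZ : ∀ s ∈ Icc 0 T, ∀ t ∈ Icc 0 T, ‖Z t - Z s‖ ≤ L * ‖X t - X s‖) :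
    IsPVarControl p T Z (fun t => L ^ p * V t) := fun s t hs hst ht => by
  calc ‖Z t - Z s‖ ^ p ≤ (L * ‖X t - X s‖) ^ p := by
        gcongr
        exact hZ s ⟨hs, hst.trans ht⟩ t ⟨hs.trans hst, ht⟩
    _ = L ^ p * ‖X t - X s‖ ^ p := Real.mul_rpow hL (norm_nonneg _)
    _ ≤ L ^ p * (V t - V s) := by gcongr; exact h s t hs hst ht
    _ = _ := mul_sub _ _ _

theorem pVar_rpow_add_le {p : ℝ} (hp : 0 < p) (X : ℝ → E) {a s t : ℝ} (has : a ≤ s) (hst : s ≤ t) :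
    pVar p X a s ^ p + (‖X t - X s‖₊ : ENNReal) ^ p ≤ pVar p X a t ^ p := by
  have key : ∀ (k : ℕ) (τ : Fin (k + 1) → ℝ), Monotone τ ∧ τ 0 = a ∧ τ (Fin.last k) = s →
      ∑ i : Fin k, (‖X (τ i.succ) - X (τ i.castSucc)‖₊ : ENNReal) ^ p
        + (‖X t - X s‖₊ : ENNReal) ^ p ≤ pVar p X a t ^ p := by
    rintro k τ ⟨hτ, h0, hl⟩
    rw [← ENNReal.rpow_inv_le_iff hp, ← one_div]
    set σ : Fin (k + 1 + 1) → ℝ := Fin.snoc (α := fun _ => ℝ) τ t with hσ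
    have h1 : ∀ i : Fin (k + 1), σ i.castSucc = τ i := fun i => by rw [hσ, Fin.snoc_castSucc]
    have h2 : σ (Fin.last (k + 1)) = t := by rw [hσ, Fin.snoc_last]
    have hmono : Monotone σ := by
      rw [Fin.monotone_iff_le_succ]
      intro i
      refine Fin.lastCases ?_ (fun i => ?_) i
      · rw [h1, Fin.succ_last, h2, hl]; exact hst
      · rw [h1, ← Fin.castSucc_succ, h1]; exact hτ (Fin.castSucc_le_succ i)
    have := le_iSup₂_of_le (f := fun (k : ℕ) (t' : Fin (k + 1) → ℝ) =>
      ⨆ (_ : Monotone t' ∧ t' 0 = a ∧ t' (Fin.last k) = t),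
        (∑ i : Fin k, (‖X (t' i.succ) - X (t' i.castSucc)‖₊ : ENNReal) ^ p) ^ (1 / p))
      (k + 1) σ (le_iSup_of_le ⟨hmono, by rw [← Fin.castSucc_zero, h1, h0], h2⟩ le_rfl)
    rw [Fin.sum_univ_castSucc] at this
    simpa only [pVar, h1, h2, hl, Fin.succ_last, ← Fin.castSucc_succ] using this
  refine add_le_of_le_tsub_right_of_le ?_ ?_
  · refine le_add_self.trans (key 1 ![a, s] ⟨?_, rfl, rfl⟩)
    rw [Fin.monotone_iff_le_succ]
    simpa using has
  · rw [← ENNReal.le_rpow_inv_iff hp, ← one_div]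
    refine iSup_le fun k => iSup₂_le fun τ hτ => ?_
    gcongr
    exact ENNReal.le_sub_of_add_le_right (by simp [hp.le]) (key k τ hτ)

theorem MemVp.exists_isPVarControl {p T : ℝ} (hp : 0 < p) {X : ℝ → E} (hX : MemVp p X 0 T) :
    ∃ V, IsPVarControl p T X V := by
  have hfin : ∀ t, 0 ≤ t → t ≤ T → pVar p X 0 t ^ p ≠ ⊤ := fun t h0 ht =>
    ((le_self_add.trans (pVar_rpow_add_le hp X h0 ht)).trans_lt
      (ENNReal.rpow_lt_top_of_nonneg hp.le hX.2.ne)).ne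
  refine ⟨fun t => (pVar p X 0 t ^ p).toReal, fun s t hs hst ht => ?_⟩
  have h := ENNReal.toReal_mono (hfin t (hs.trans hst) ht) (pVar_rpow_add_le hp X hs hst)
  have hn : ((‖X t - X s‖₊ : ENNReal) ^ p).toReal = ‖X t - X s‖ ^ p := by
    rw [← ENNReal.toReal_rpow, ENNReal.coe_toReal, coe_nnnorm]
  rw [ENNReal.toReal_add (hfin s hs (hst.trans ht)) (by simp [hp.le]), hn] at h
  linarith

theorem IsPVarControl.memVp {p T : ℝ} (hp : 0 < p) {X : ℝ → E} {V : ℝ → ℝ}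
    (h : IsPVarControl p T X V) (hX : ContinuousOn X (Icc 0 T)) : MemVp p X 0 T := by
  refine ⟨hX, lt_of_le_of_lt (b := ENNReal.ofReal (V T - V 0) ^ (1 / p)) ?_
    (ENNReal.rpow_lt_top_of_nonneg (by positivity) ENNReal.ofReal_ne_top)⟩
  refine iSup_le fun k => iSup₂_le fun τ hτ => ?_
  obtain ⟨hmono, h0, hl⟩ := hτ
  gcongr
  have hinc : ∀ i : Fin k, ‖X (τ i.succ) - X (τ i.castSucc)‖ ^ p
      ≤ V (τ i.succ) - V (τ i.castSucc) := fun i =>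
    h _ _ (h0 ▸ hmono (Fin.zero_le _)) (hmono (Fin.castSucc_le_succ i)) (hl ▸ hmono (Fin.le_last _))
  have htel : ∑ i : Fin k, (V (τ i.succ) - V (τ i.castSucc)) = V T - V 0 := by
    rw [Finset.sum_sub_distrib, ← hl, ← h0]
    have h1 := Fin.sum_univ_succ fun i => V (τ i)
    have h2 := Fin.sum_univ_castSucc fun i => V (τ i)
    linarith
  calc _ = ∑ i : Fin k, ENNReal.ofReal (‖X (τ i.succ) - X (τ i.castSucc)‖ ^ p) := by
        refine Finset.sum_congr rfl fun i _ => ?_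
        rw [← ENNReal.ofReal_rpow_of_nonneg (norm_nonneg _) hp.le, ofReal_norm]
        rfl
    _ = ENNReal.ofReal (∑ i : Fin k, ‖X (τ i.succ) - X (τ i.castSucc)‖ ^ p) :=
        (ENNReal.ofReal_sum_of_nonneg fun i _ => by positivity).symm
    _ ≤ _ := ENNReal.ofReal_le_ofReal ((Finset.sum_le_sum fun i _ => hinc i).trans_eq htel)

end PVariation

section YoungIntegral

theorem YoungPartition.mesh_nonneg {a b : ℝ} (D : YoungPartition a b) : 0 ≤ D.mesh :=
  Real.iSup_nonneg fun i => sub_nonneg.2 (D.mono (Fin.castSucc_le_succ i))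

variable {F : Type*} [NormedAddCommGroup F] [NormedSpace ℝ F]

/-- Young integrals against a scalar path are the limits of the sums of the germ
`(X t - X s) • Z s`. -/
theorem isYoungIntegral_toCLM_iff {Z : ℝ → F} {X : ℝ → ℝ} {a b : ℝ} {I : F} :
    IsYoungIntegral (fun s => toCLM (Z s)) X a b I
      ↔ SumsTendsto (fun s t => (X t - X s) • Z s) a b I := by
  rw [IsYoungIntegral, (Metric.nhds_basis_closedBall.comap YoungPartition.mesh).tendsto_iff
    Metric.nhds_basis_closedBall]
  simp only [mem_preimage, Metric.mem_closedBall, dist_eq_norm, sub_zero, Real.norm_eq_abs]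
  refine forall₂_congr fun ε _ => exists_congr fun δ => and_congr_right fun hδ => ?_
  constructor
  · intro h N t ht
    have := h ⟨N, fun i => t i, fun i j hij => ht.mono hij, ht.first, by simpa using ht.last⟩ (by
      rw [abs_of_nonneg (YoungPartition.mesh_nonneg _)]
      exact Real.iSup_le (fun i => by simpa using ht.step i i.2) (le_of_lt hδ))
    simpa [riemannSum, toCLM, ← Fin.sum_univ_eq_sum_range
      (fun i => (X (t (i + 1)) - X (t i)) • Z (t i))] using this
  · intro h D hD
    have hu : ∀ i : Fin (D.k + 1), D.t ⟨min i D.k, by omega⟩ = D.t i := fun i => by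
      congr; omega
    have hstep : ∀ i : Fin D.k, D.t i.succ - D.t i.castSucc ≤ D.mesh := fun i =>
      le_ciSup (f := fun i : Fin D.k => D.t i.succ - D.t i.castSucc)
        (Set.finite_range _).bddAbove i
    have := h D.k (fun i => D.t ⟨min i D.k, by omega⟩)
      ⟨fun i j hij => D.mono (by rw [Fin.mk_le_mk]; omega), by simpa using D.first,
        (hu (Fin.last _)).trans D.last, fun i hi => by
          have e1 := hu (Fin.castSucc ⟨i, hi⟩)
          have e2 := hu (Fin.succ ⟨i, hi⟩)
          simp only [Fin.val_castSucc, Fin.val_succ] at e1 e2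
          rw [e1, e2]
          exact (hstep ⟨i, hi⟩).trans ((le_abs_self _).trans hD)⟩
    have hsum : riemannSum (fun s => toCLM (Z s)) X D = ∑ i ∈ Finset.range D.k,
        (X (D.t ⟨min (i + 1) D.k, by omega⟩) - X (D.t ⟨min i D.k, by omega⟩))
          • Z (D.t ⟨min i D.k, by omega⟩) := by
      rw [← Fin.sum_univ_eq_sum_range (fun i => (X (D.t ⟨min (i + 1) D.k, by omega⟩)
        - X (D.t ⟨min i D.k, by omega⟩)) • Z (D.t ⟨min i D.k, by omega⟩))]
      refine Finset.sum_congr rfl fun i _ => ?_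
      have e1 := hu i.castSucc
      have e2 := hu i.succ
      simp only [Fin.val_castSucc, Fin.val_succ] at e1 e2
      rw [e1, e2]
      simp [toCLM]
    rwa [hsum]

end YoungIntegral

section Germ

theorem ContinuousOn.exists_norm_sub_le {E : Type*} [NormedAddCommGroup E] {X : ℝ → E} {T : ℝ}
    (hX : ContinuousOn X (Icc 0 T)) {η : ℝ} (hη : 0 < η) :
    ∃ δ > 0, ∀ s t, 0 ≤ s → s ≤ t → t ≤ T → t - s ≤ δ → ‖X t - X s‖ ≤ η := by
  obtain ⟨δ, hδ, h⟩ := Metric.uniformContinuousOn_iff.1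
    (isCompact_Icc.uniformContinuousOn_of_continuous hX) η hη
  refine ⟨δ / 2, half_pos hδ, fun s t hs hst ht hd => ?_⟩
  rw [← dist_eq_norm]
  refine (h t ⟨hs.trans hst, ht⟩ s ⟨hs, hst.trans ht⟩ ?_).le
  rw [Real.dist_eq, abs_of_nonneg (sub_nonneg.2 hst)]
  linarith

theorem exists_mul_le_mul_rpow {p θ : ℝ} (hp : 0 < p) (hθ : 1 < θ) (hpθ : p * θ < 2) {ε : ℝ}
    (hε : 0 < ε) :
    ∃ η > 0, ∀ a b ω : ℝ, 0 ≤ a → 0 ≤ b → a ≤ η → b ≤ η → a ^ p ≤ ω → b ^ p ≤ ω →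
      a * b ≤ ε * ω ^ θ := by
  have hq : 0 < 2 - p * θ := sub_pos.2 hpθ
  refine ⟨ε ^ (1 / (2 - p * θ)), by positivity, fun a b ω ha hb haη hbη haω hbω => ?_⟩
  set m := max a b
  have hm : 0 ≤ m := ha.trans (le_max_left a b)
  have hmω : m ^ p ≤ ω := by rcases max_choice a b with h | h <;> simpa only [m, h]
  have hmη : m ^ (2 - p * θ) ≤ ε := by
    calc m ^ (2 - p * θ) ≤ (ε ^ (1 / (2 - p * θ))) ^ (2 - p * θ) := by
          gcongr
          exact max_le haη hbη
      _ = ε := by rw [← Real.rpow_mul hε.le, one_div_mul_cancel hq.ne', Real.rpow_one]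
  calc a * b ≤ m * m := by gcongr; exacts [le_max_left a b, le_max_right a b]
    _ = m ^ (2 - p * θ) * (m ^ p) ^ θ := by
        rw [← Real.rpow_mul hm, ← Real.rpow_add_of_nonneg hm hq.le (by positivity),
          sub_add_cancel, Real.rpow_two, sq]
    _ ≤ ε * ω ^ θ := by gcongr

/-- Products of increments of two paths of finite `p`-variation are small of order `2 / p`. -/
theorem IsPVarControl.exists_norm_mul_norm_le {E F : Type*} [NormedAddCommGroup E]
    [NormedAddCommGroup F] {p θ T : ℝ} {V : ℝ → ℝ} {X : ℝ → E} {Y : ℝ → F}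
    (hXV : IsPVarControl p T X V) (hYV : IsPVarControl p T Y V) (hX : ContinuousOn X (Icc 0 T))
    (hY : ContinuousOn Y (Icc 0 T)) (hp : 0 < p) (hθ : 1 < θ) (hpθ : p * θ < 2) {ε : ℝ}
    (hε : 0 < ε) :
    ∃ δ > 0, ∀ s t, 0 ≤ s → t ≤ T → t - s ≤ δ → ∀ a b c d, s ≤ a → a ≤ b → b ≤ t → s ≤ c →
      c ≤ d → d ≤ t → ‖X b - X a‖ * ‖Y d - Y c‖ ≤ ε * (V t - V s) ^ θ := by
  obtain ⟨η, hη, h⟩ := exists_mul_le_mul_rpow hp hθ hpθ hε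
  obtain ⟨δ, hδ, h1⟩ := hX.exists_norm_sub_le hη
  obtain ⟨δ', hδ', h2⟩ := hY.exists_norm_sub_le hη
  refine ⟨min δ δ', lt_min hδ hδ', fun s t hs ht hst a b c d ha hab hb hc hcd hd => ?_⟩
  have hsub : ∀ x y, s ≤ x → x ≤ y → y ≤ t → V y - V x ≤ V t - V s := fun x y hx hxy hy => by
    have e1 := hXV.monotoneOn ⟨hs, (hx.trans (hxy.trans hy)).trans ht⟩
      ⟨hs.trans hx, (hxy.trans hy).trans ht⟩ hx
    have e2 := hXV.monotoneOn ⟨hs.trans (hx.trans hxy), hy.trans ht⟩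
      ⟨hs.trans (hx.trans (hxy.trans hy)), ht⟩ hy
    linarith
  have hδ1 := min_le_left δ δ'
  have hδ2 := min_le_right δ δ'
  exact h _ _ _ (norm_nonneg _) (norm_nonneg _)
    (h1 a b (hs.trans ha) hab (hb.trans ht) (by linarith))
    (h2 c d (hs.trans hc) hcd (hd.trans ht) (by linarith))
    ((hXV a b (hs.trans ha) hab (hb.trans ht)).trans (hsub a b ha hab hb))
    ((hYV c d (hs.trans hc) hcd (hd.trans ht)).trans (hsub c d hc hcd hd))

theorem AlmostAdditive.sum {F : Type*} [NormedAddCommGroup F] {ι : Type*} (S : Finset ι)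
    {Ξ : ι → ℝ → ℝ → F} {V : ℝ → ℝ} {θ T : ℝ} (hV : MonotoneOn V (Icc 0 T))
    (h : ∀ i ∈ S, AlmostAdditive (Ξ i) V θ T) :
    AlmostAdditive (fun s t => ∑ i ∈ S, Ξ i s t) V θ T := by
  classical
  induction S using Finset.induction_on with
  | empty =>
    refine fun ε hε => ⟨1, one_pos, fun s u t hs hsu hut ht _ => ?_⟩
    have := sub_nonneg.2 (hV ⟨hs, (hsu.trans hut).trans ht⟩ ⟨hs.trans (hsu.trans hut), ht⟩
      (hsu.trans hut))
    simp only [Finset.sum_empty, sub_zero, norm_zero]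
    positivity
  | insert i S hi ih =>
    intro ε hε
    obtain ⟨δ, hδ, h1⟩ := h i (Finset.mem_insert_self i S) (ε / 2) (half_pos hε)
    obtain ⟨δ', hδ', h2⟩ := ih (fun j hj => h j (Finset.mem_insert_of_mem hj)) (ε / 2) (half_pos hε)
    refine ⟨min δ δ', lt_min hδ hδ', fun s u t hs hsu hut ht hst => ?_⟩
    simp only [Finset.sum_insert hi]
    rw [add_sub_add_comm, add_sub_add_comm]
    refine (norm_add_le _ _).trans ?_
    linarith [h1 s u t hs hsu hut ht (hst.trans (min_le_left _ _)),
      h2 s u t hs hsu hut ht (hst.trans (min_le_right _ _))]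

/-- The germ of the Young integral of a Lipschitz function of `Y` against `X`. -/
theorem IsPVarControl.almostAdditive_smul {E F : Type*} [NormedAddCommGroup E]
    [NormedAddCommGroup F] [NormedSpace ℝ F] {p θ T L : ℝ} {V X : ℝ → ℝ} {Y : ℝ → E} {Z : ℝ → F}
    (hXV : IsPVarControl p T X V) (hYV : IsPVarControl p T Y V) (hX : ContinuousOn X (Icc 0 T))
    (hY : ContinuousOn Y (Icc 0 T)) (hp : 0 < p) (hθ : 1 < θ) (hpθ : p * θ < 2) (hL : 0 ≤ L)
    (hZ : ∀ s ∈ Icc 0 T, ∀ t ∈ Icc 0 T, ‖Z t - Z s‖ ≤ L * ‖Y t - Y s‖) :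
    AlmostAdditive (fun s t => (X t - X s) • Z s) V θ T := by
  intro ε hε
  obtain ⟨δ, hδ, h⟩ := hXV.exists_norm_mul_norm_le hYV hX hY hp hθ hpθ
    (show 0 < ε / (L + 1) by positivity)
  refine ⟨δ, hδ, fun s u t hs hsu hut ht hst => ?_⟩
  have e : (X t - X s) • Z s - (X u - X s) • Z s - (X t - X u) • Z u
      = -((X t - X u) • (Z u - Z s)) := by
    rw [smul_sub, ← sub_smul, sub_sub_sub_cancel_right, neg_sub]
  have hP := h s t hs ht hst u t s u hsu hut le_rfl le_rfl hsu hut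
  have hP0 : 0 ≤ ‖X t - X u‖ * ‖Y u - Y s‖ := by positivity
  rw [e, norm_neg, norm_smul]
  calc ‖X t - X u‖ * ‖Z u - Z s‖ ≤ ‖X t - X u‖ * (L * ‖Y u - Y s‖) := by
        gcongr
        exact hZ s ⟨hs, (hsu.trans hut).trans ht⟩ u ⟨hs.trans hsu, hut.trans ht⟩
    _ ≤ (L + 1) * (‖X t - X u‖ * ‖Y u - Y s‖) := by linarith
    _ ≤ (L + 1) * (ε / (L + 1) * (V t - V s) ^ θ) := by gcongr
    _ = ε * (V t - V s) ^ θ := by field_simp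

end Germ

section Compact

variable {E F : Type*} [NormedAddCommGroup E] [NormedSpace ℝ E] [NormedAddCommGroup F]
  [NormedSpace ℝ F]

theorem IsCompact.exists_convex_isCompact_superset [CompleteSpace E] {S : Set E}
    (hS : IsCompact S) : ∃ K, IsCompact K ∧ Convex ℝ K ∧ S ⊆ K :=
  ⟨closure (convexHull ℝ S),
    hS.totallyBounded.convexHull.closure.isCompact_of_isClosed
      isClosed_closure,
    (convex_convexHull ℝ S).closure, (subset_convexHull ℝ S).trans subset_closure⟩

theorem ContDiff.exists_norm_fderiv_le_of_isCompact {G : E → F} (hG : ContDiff ℝ 1 G) {K : Set E}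
    (hK : IsCompact K) : ∃ L, 0 ≤ L ∧ ∀ x ∈ K, ‖fderiv ℝ G x‖ ≤ L := by
  obtain ⟨L, hL⟩ := hK.exists_bound_of_continuousOn (hG.continuous_fderiv one_ne_zero).continuousOn
  exact ⟨max L 0, le_max_right _ _, fun x hx => (hL x hx).trans (le_max_left _ _)⟩

theorem ContDiff.exists_lipschitz_of_isCompact {G : E → F} (hG : ContDiff ℝ 1 G) {K : Set E}
    (hK : IsCompact K) (hc : Convex ℝ K) :
    ∃ L, 0 ≤ L ∧ ∀ x ∈ K, ∀ y ∈ K, ‖G y - G x‖ ≤ L * ‖y - x‖ := by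
  obtain ⟨L, hL0, hL⟩ := hG.exists_norm_fderiv_le_of_isCompact hK
  exact ⟨L, hL0, fun x hx y hy => hc.norm_image_sub_le_of_norm_fderiv_le
    (fun z _ => hG.differentiable one_ne_zero z) hL hx hy⟩

/-- First order Taylor estimate for a `C²` map, uniform on convex compact sets. -/
theorem ContDiff.exists_norm_sub_sub_fderiv_le_sq {G : E → F} (hG : ContDiff ℝ 2 G) {K : Set E}
    (hK : IsCompact K) (hc : Convex ℝ K) :
    ∃ C, 0 ≤ C ∧ ∀ x ∈ K, ∀ y ∈ K,
      ‖G y - G x - fderiv ℝ G x (y - x)‖ ≤ C * (‖y - x‖ * ‖y - x‖) := by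
  obtain ⟨C, hC0, hC⟩ := (hG.fderiv_right (m := 1) (by norm_num)).exists_lipschitz_of_isCompact hK hc
  refine ⟨C, hC0, fun x hx y hy => ?_⟩
  rw [← mul_assoc]
  refine (convex_segment x y).norm_image_sub_le_of_norm_fderiv_le'
    (fun z _ => hG.differentiable two_ne_zero z) (fun z hz => ?_)
    (left_mem_segment ℝ x y) (right_mem_segment ℝ x y)
  refine (hC x hx z (hc.segment_subset hx hy hz)).trans ?_
  gcongr
  obtain ⟨θ, hθ, rfl⟩ := (segment_eq_image' ℝ x y ▸ hz :)
  rw [add_sub_cancel_left, norm_smul, Real.norm_of_nonneg hθ.1]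
  exact mul_le_of_le_one_left (norm_nonneg _) hθ.2

end Compact

/-- Chain rule: if the germ `Ξ` approximates the increments of `Y`, then `DG(Y_s) Ξ_{s,t}`
approximates those of `G ∘ Y`. -/
theorem ApproxIncrements.comp_contDiff {E F : Type*} [NormedAddCommGroup E] [NormedSpace ℝ E]
    [CompleteSpace E] [NormedAddCommGroup F] [NormedSpace ℝ F] {p θ T : ℝ} {V : ℝ → ℝ}
    {Ξ : ℝ → ℝ → E} {Y : ℝ → E} (h : ApproxIncrements Ξ Y V θ T) (hYV : IsPVarControl p T Y V)
    (hY : ContinuousOn Y (Icc 0 T)) (hp : 0 < p) (hθ : 1 < θ) (hpθ : p * θ < 2) {G : E → F}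
    (hG : ContDiff ℝ 2 G) :
    ApproxIncrements (fun s t => fderiv ℝ G (Y s) (Ξ s t)) (fun t => G (Y t)) V θ T := by
  obtain ⟨K, hK, hKc, hYK⟩ := (isCompact_Icc.image_of_continuousOn hY).exists_convex_isCompact_superset
  replace hYK : ∀ t, 0 ≤ t → t ≤ T → Y t ∈ K := fun t h0 ht => hYK (mem_image_of_mem Y ⟨h0, ht⟩)
  obtain ⟨C, hC0, hC⟩ := hG.exists_norm_sub_sub_fderiv_le_sq hK hKc
  obtain ⟨L, hL0, hL⟩ := (hG.of_le one_le_two).exists_norm_fderiv_le_of_isCompact hK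
  intro ε hε
  obtain ⟨δ, hδ, h1⟩ := h (ε / (L + C + 1)) (by positivity)
  obtain ⟨δ', hδ', h2⟩ := hYV.exists_norm_mul_norm_le hYV hY hY hp hθ hpθ
    (show 0 < ε / (L + C + 1) by positivity)
  refine ⟨min δ δ', lt_min hδ hδ', fun s t hs hst ht hd => ?_⟩
  have e1 := h1 s t hs hst ht (hd.trans (min_le_left _ _))
  have e2 := h2 s t hs ht (hd.trans (min_le_right _ _)) s t s t le_rfl hst le_rfl le_rfl hst le_rfl
  set W := ε / (L + C + 1) * (V t - V s) ^ θ with hW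
  have hW0 : 0 ≤ W := (norm_nonneg _).trans e1
  have hYs := hYK s hs (hst.trans ht)
  calc ‖G (Y t) - G (Y s) - fderiv ℝ G (Y s) (Ξ s t)‖
      = ‖(G (Y t) - G (Y s) - fderiv ℝ G (Y s) (Y t - Y s))
          + fderiv ℝ G (Y s) (Y t - Y s - Ξ s t)‖ := by rw [map_sub _ (Y t - Y s)]; congr 1; abel
    _ ≤ C * W + L * W := by
        refine (norm_add_le _ _).trans (add_le_add ?_ ?_)
        · exact (hC _ hYs _ (hYK t (hs.trans hst) ht)).trans (by gcongr)
        · exact (ContinuousLinearMap.le_of_opNorm_le _ (hL _ hYs) _).trans (by gcongr)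
    _ ≤ (L + C + 1) * W := by linarith
    _ = ε * (V t - V s) ^ θ := by rw [hW]; field_simp

/-- If the vector field `g` commutes with all the `f_i` (`[g,f_i] = 0`) and has a globally
defined flow `Φ` by twice continuously differentiable diffeomorphisms, then `g` is an
infinitesimal symmetry of `dY = Σ_i f_i(Y)dX^i`: every `Φ_t` is a symmetry, i.e. for every
solution `Y` starting at `y₀` the path `Φ_t ∘ Y` is a solution starting at `Φ_t(y₀)`. -/
theorem infinitesimal_symmetry_young
    {n : ℕ} {E₁ : Type*} [NormedAddCommGroup E₁] [NormedSpace ℝ E₁] [CompleteSpace E₁]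
    (p γ T : ℝ) (hp1 : 1 ≤ p) (hp2 : p < 2) (hγ0 : 0 < γ) (hγ1 : γ ≤ 1)
    (hγp : 1 + γ > p) (hT : 0 ≤ T)
    (X : ℝ → Fin n → ℝ) (hX : MemVp p X 0 T)
    (f : E₁ → (Fin n → ℝ) →L[ℝ] E₁)
    (hf : ∃ C : ℝ, ∀ x y : E₁, ‖f x - f y‖ ≤ C * ‖x - y‖ ^ γ)
    (hfC1 : ∀ i : Fin n, ContDiff ℝ 1 fun y => f y (Pi.single i 1))
    (g : E₁ → E₁) (hg : ContDiff ℝ 2 g)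
    (Φ : ℝ → E₁ → E₁)
    (hΦ0 : ∀ y, Φ 0 y = y)
    (hflow : ∀ (t : ℝ) (y : E₁), HasDerivAt (fun s => Φ s y) (g (Φ t y)) t)
    (hdiffeo : ∀ t : ℝ, ContDiff ℝ 2 (Φ t) ∧
      ∃ Ψ : E₁ → E₁, Function.LeftInverse Ψ (Φ t) ∧ Function.RightInverse Ψ (Φ t) ∧
        ContDiff ℝ 2 Ψ)
    (hbracket : ∀ (y : E₁) (i : Fin n),
      fderiv ℝ (fun z => f z (Pi.single i 1)) y (g y)
        - fderiv ℝ g y (f y (Pi.single i 1)) = 0) :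
    ∀ t : ℝ, ∀ (y₀ : E₁) (Y : ℝ → E₁), IsYoungSolution p T X f y₀ Y →
      IsYoungSolution p T X f (Φ t y₀) (fun s => Φ t (Y s)) := by

  intro τ y₀ Y ⟨hY0, hYmem, hYint⟩
  have hp : 0 < p := by linarith
  obtain ⟨θ, hθ, hpθ⟩ : ∃ θ, 1 < θ ∧ p * θ < 2 := by
    obtain ⟨θ, h1, h2⟩ := exists_between ((one_lt_div hp).2 hp2)
    exact ⟨θ, h1, by rwa [mul_comm, ← lt_div_iff₀ hp]⟩
  have hYc := hYmem.1
  have hXc : ∀ i, ContinuousOn (fun s => X s i) (Icc 0 T) := fun i =>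
    (continuous_apply i).comp_continuousOn hX.1
  obtain ⟨V₁, hV₁⟩ := hX.exists_isPVarControl hp
  obtain ⟨V₂, hV₂⟩ := hYmem.exists_isPVarControl hp
  obtain ⟨V, hXV, hYV⟩ : ∃ V, IsPVarControl p T X V ∧ IsPVarControl p T Y V :=
    ⟨V₁ + V₂, hV₁.add_right hV₂.monotoneOn, add_comm V₂ V₁ ▸ hV₂.add_right hV₁.monotoneOn⟩
  have hV := hYV.monotoneOn
  have hXiV : ∀ i, IsPVarControl p T (fun s => X s i) V := fun i s t hs hst ht =>
    (Real.rpow_le_rpow (norm_nonneg _) (norm_le_pi_norm (X t - X s) i) hp.le).trans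
      (hXV s t hs hst ht)
  obtain ⟨K, hK, hKc, hYK⟩ :=
    (isCompact_Icc.image_of_continuousOn hYc).exists_convex_isCompact_superset
  have hφ := (hdiffeo τ).1
  have hlip : ∀ G : E₁ → E₁, ContDiff ℝ 1 G → ∃ L, 0 ≤ L ∧
      ∀ s ∈ Icc 0 T, ∀ t ∈ Icc 0 T, ‖G (Y t) - G (Y s)‖ ≤ L * ‖Y t - Y s‖ := fun G hG => by
    obtain ⟨L, hL0, hL⟩ := hG.exists_lipschitz_of_isCompact hK hKc
    exact ⟨L, hL0, fun s hs t ht =>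
      hL _ (hYK (mem_image_of_mem Y hs)) _ (hYK (mem_image_of_mem Y ht))⟩
  have hgerm : ∀ G : E₁ → E₁, ContDiff ℝ 1 G → ∀ i,
      AlmostAdditive (fun s t => (X t i - X s i) • G (Y s)) V θ T := fun G hG i => by
    obtain ⟨L, hL0, hL⟩ := hlip G hG
    exact (hXiV i).almostAdditive_smul hYV (hXc i) hYc hp hθ hpθ hL0 hL
  have hYapp : ApproxIncrements (fun s t => ∑ i, (X t i - X s i) • f (Y s) (Pi.single i 1))
      Y V θ T := by
    refine (AlmostAdditive.sum Finset.univ hV fun i _ => hgerm _ (hfC1 i) i).approxIncrements hV hθ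
      fun t ht => ?_
    obtain ⟨I, hI, hYt⟩ := hYint t ht
    rw [hYt, hY0, add_sub_cancel_left]
    exact SumsTendsto.sum Finset.univ fun i _ => isYoungIntegral_toCLM_iff.1 (hI i)
  have hφapp : ApproxIncrements (fun s t => ∑ i, (X t i - X s i) • f (Φ τ (Y s)) (Pi.single i 1))
      (fun s => Φ τ (Y s)) V θ T := by
    convert hYapp.comp_contDiff hYV hYc hp hθ hpθ hφ using 3 with s t
    rw [map_sum]
    refine Finset.sum_congr rfl fun i _ => ?_
    rw [map_smul, fderiv_flow_apply (w := fun z => f z (Pi.single i 1)) (hg.of_le one_le_two)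
      hΦ0 hflow ((hfC1 i).differentiable one_ne_zero) (fun y => sub_eq_zero.1 (hbracket y i))
      (hφ.differentiable two_ne_zero _)]
  refine ⟨by simp only [hY0], ?_, fun t ht => ?_⟩
  · obtain ⟨L, hL0, hL⟩ := hlip _ (hφ.of_le one_le_two)
    exact (hYV.of_norm_sub_le hp.le hL0 hL).memVp hp (hφ.continuous.comp_continuousOn hYc)
  · choose J hJ using fun i => (hgerm (fun z => f (Φ τ z) (Pi.single i 1))
      ((hfC1 i).comp (hφ.of_le one_le_two)) i).exists_sumsTendsto hV hθ le_rfl ht.1 ht.2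
    refine ⟨J, fun i => isYoungIntegral_toCLM_iff.2 (hJ i), ?_⟩
    have := (SumsTendsto.sum Finset.univ fun i _ => hJ i).unique ht.1
      (hφapp.sumsTendsto hV hθ le_rfl ht.1 ht.2)
    rw [this, hY0, add_sub_cancel]
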